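/- arXiv:1309.3381 — 3 statements merged into one kernel-verified Lean document; each statement's English description precedes it below -/
import Mathlib

section
/- Let d, d' ∈ ℕ, let F and F' be finite groups, let G = ℤ^d × F and G' = ℤ^{d'} × F', and let S ⊆ G and S' ⊆ G' be finite symmetric generating sets with β_{G,S} = β_{G',S'}. Then |F| ≡ |F'| (mod 2). -/
/-- `S` is a monoid generating set of the group `G`: every element of `G` is a
product of finitely many elements of `S`. -/
def IsMonGenSet {G : Type*} [Group G] (S : Set G) : Prop := Submonoid.closure S = ⊤

/-- `S` is symmetric: closed under inverses. -/
def IsSymmSet {G : Type*} [Group G] (S : Set G) : Prop := ∀ s ∈ S, s⁻¹ ∈ S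

/-- The word length of `g` with respect to `S`: the least `n` such that `g` is a
product of `n` elements of `S`. -/
noncomputable def wlen {G : Type*} [Group G] (S : Set G) (g : G) : ℕ :=
  sInf {n | ∃ l : List G, (∀ x ∈ l, x ∈ S) ∧ l.length = n ∧ l.prod = g}

/-- The growth function `β_{G,S}`: the cardinality of the ball of radius `r`. -/
noncomputable def growth {G : Type*} [Group G] (S : Set G) (r : ℕ) : ℕ :=
  Set.ncard {g : G | wlen S g ≤ r}

/-- The spherical growth function `σ_{G,S}`. -/
noncomputable def sph {G : Type*} [Group G] (S : Set G) (r : ℕ) : ℕ :=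
  Set.ncard {g : G | wlen S g = r}

/-- The standard symmetric generating set `E_d ∪ (-E_d)` of `ℤ^d`. -/
def stdSymmSet (d : ℕ) : Set (Multiplicative (Fin d → ℤ)) :=
  {x | ∃ i : Fin d, x = Multiplicative.ofAdd (Pi.single i 1) ∨
       x = Multiplicative.ofAdd (-Pi.single i 1)}

/-- The standard symmetric growth function `β_d` of `ℤ^d`. -/
noncomputable def betaStd (d : ℕ) : ℕ → ℕ := growth (stdSymmSet d)

/-- The standard monoid generating set `E_d ∪ {v_d}` of `ℤ^d`. -/
def stdMonSet (d : ℕ) : Set (Multiplicative (Fin d → ℤ)) :=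
  {x | (∃ i : Fin d, x = Multiplicative.ofAdd (Pi.single i 1)) ∨
       x = Multiplicative.ofAdd (fun _ => (-1 : ℤ))}

/-- The standard monoid growth function `β⁺_d` of `ℤ^d`. -/
noncomputable def betaPlus (d : ℕ) : ℕ → ℕ := growth (stdMonSet d)

/-- The rank of a finitely generated abelian group. -/
noncomputable def rk (G : Type*) [CommGroup G] : ℕ := Module.finrank ℤ (Additive G)

section WordLength

variable {G : Type*} [Group G] {S : Set G}

/-- If `S` generates, every `g` is a product of `wlen S g` elements of `S`. -/
theorem exists_list_length_eq_wlen (hgen : IsMonGenSet S) (g : G) :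
    ∃ l : List G, (∀ x ∈ l, x ∈ S) ∧ l.length = wlen S g ∧ l.prod = g := by
  have hg : g ∈ Submonoid.closure S := by rw [hgen]; trivial
  obtain ⟨l, hl, hprod⟩ := Submonoid.exists_list_of_mem_closure hg
  exact Nat.sInf_mem (s := {n | ∃ l : List G, (∀ x ∈ l, x ∈ S) ∧ l.length = n ∧ l.prod = g})
    ⟨l.length, l, hl, rfl, hprod⟩

theorem wlen_prod_le_length {l : List G} (hl : ∀ x ∈ l, x ∈ S) : wlen S l.prod ≤ l.length :=
  Nat.sInf_le ⟨l, hl, rfl, rfl⟩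

theorem wlen_inv_le (hgen : IsMonGenSet S) (hsymm : IsSymmSet S) (g : G) :
    wlen S g⁻¹ ≤ wlen S g := by
  obtain ⟨l, hl, hlen, hprod⟩ := exists_list_length_eq_wlen hgen g
  have hmem : ∀ x ∈ (l.map fun y => y⁻¹).reverse, x ∈ S := by
    intro x hx
    obtain ⟨y, hy, rfl⟩ := List.mem_map.1 (List.mem_reverse.1 hx)
    exact hsymm y (hl y hy)
  have hle := wlen_prod_le_length hmem
  rwa [← List.prod_inv_reverse, hprod, List.length_reverse, List.length_map, hlen] at hle

theorem finite_setOf_wlen_le (hS : S.Finite) (hgen : IsMonGenSet S) (r : ℕ) :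
    {g : G | wlen S g ≤ r}.Finite := by
  have : Finite S := hS
  refine ((List.finite_length_le S r).image fun l => (l.map Subtype.val).prod).subset ?_
  intro g hg
  obtain ⟨l, hl, hlen, hprod⟩ := exists_list_length_eq_wlen hgen g
  lift l to List S using hl
  refine ⟨l, ?_, hprod⟩
  rw [List.length_map] at hlen
  exact hlen.trans_le hg

end WordLength

/-- A finite inverse-closed set without solutions of `g⁻¹ = g` has even cardinality. -/
theorem even_ncard_of_inv_mem {G : Type*} [Group G] {T : Set G} (hT : T.Finite)
    (hinv : ∀ g ∈ T, g⁻¹ ∈ T) (hne : ∀ g ∈ T, g⁻¹ ≠ g) : Even T.ncard := by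
  rw [Set.ncard_eq_toFinset_card T hT, ← ZMod.natCast_eq_zero_iff_even, Finset.cast_card]
  refine Finset.sum_involution (fun g _ => g⁻¹) (fun _ _ => by decide) ?_ ?_ ?_
  · intro g hg _
    exact hne g (hT.mem_toFinset.1 hg)
  · intro g hg
    exact hT.mem_toFinset.2 (hinv g (hT.mem_toFinset.1 hg))
  · intro g _
    exact inv_inv g

/-- For a symmetric generating set of the product of a torsion-free group `A` and a finite
group `F`, the growth function eventually has the parity of the order of `F`. -/
theorem eventually_growth_mod_two_eq {A F : Type*} [Group A] [IsMulTorsionFree A] [Group F]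
    [Finite F] {S : Set (A × F)} (hS : S.Finite) (hsymm : IsSymmSet S) (hgen : IsMonGenSet S) :
    ∀ᶠ r in Filter.atTop, growth S r % 2 = Nat.card F % 2 := by
  have hbound : ∀ᶠ r in Filter.atTop, ∀ f : F, wlen S ((1 : A), f) ≤ r :=
    Filter.eventually_all.2 fun f => Filter.eventually_ge_atTop _
  filter_upwards [hbound] with r hr
  have hfin := finite_setOf_wlen_le hS hgen r
  have hsub : Set.range (fun f : F => ((1 : A), f)) ⊆ {g | wlen S g ≤ r} := by
    rintro _ ⟨f, rfl⟩
    exact hr f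
  have hcard : (Set.range fun f : F => ((1 : A), f)).ncard = Nat.card F :=
    Set.ncard_range_of_injective (Prod.mk_right_injective 1)
  have heven : Even ({g | wlen S g ≤ r} \ Set.range fun f : F => ((1 : A), f)).ncard := by
    refine even_ncard_of_inv_mem hfin.sdiff ?_ ?_
    · rintro g ⟨hg, hg'⟩
      refine ⟨(wlen_inv_le hgen hsymm g).trans hg, ?_⟩
      rintro ⟨f, hf⟩
      exact hg' ⟨f⁻¹, by rw [← inv_inv g, ← hf]; simp⟩
    · rintro ⟨a, f⟩ ⟨-, hg'⟩ heq
      have ha : a⁻¹ = a := congrArg Prod.fst heq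
      have ha' : a ^ 2 = 1 := by rw [pow_two]; nth_rewrite 1 [← ha]; exact inv_mul_cancel a
      exact hg' ⟨f, by rw [(pow_eq_one_iff_left two_ne_zero).1 ha']⟩
  have hadd := Set.ncard_sdiff_add_ncard_of_subset hsub hfin
  rw [hcard] at hadd
  obtain ⟨k, hk⟩ := heven
  unfold growth
  omega

/-- Necessary condition: equal growth functions of `ℤ^d × F` and `ℤ^{d'} × F'` with
respect to finite symmetric generating sets force `|F| ≡ |F'| mod 2`. -/
theorem card_torsion_parity_eq_of_symmetric_growth_eq (d d' : ℕ)
    (F F' : Type*) [Group F] [Group F'] [Finite F] [Finite F']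
    (S : Set (Multiplicative (Fin d → ℤ) × F)) (S' : Set (Multiplicative (Fin d' → ℤ) × F'))
    (hS : S.Finite) (hS' : S'.Finite)
    (hsymm : IsSymmSet S) (hsymm' : IsSymmSet S')
    (hgen : IsMonGenSet S) (hgen' : IsMonGenSet S')
    (h : growth S = growth S') : Nat.card F % 2 = Nat.card F' % 2 := by
  obtain ⟨r, hr, hr'⟩ := ((eventually_growth_mod_two_eq hS hsymm hgen).and
    (eventually_growth_mod_two_eq hS' hsymm' hgen')).exists
  rw [← hr, ← hr', h]
end

section
/- Let m ∈ ℕ with m > 0, let F₁, …, F_m be finite groups, let d ∈ ℕ with d > 0, and set G_j := ℤ^d × F_j for j ∈ {1, …, m}. Then for every j ∈ {1, …, m} there exists a finite monoid generating set S_j ⊆ G_j of G_j such that σ_{G₁,S₁} = ⋯ = σ_{G_m,S_m}, and consequently β_{G₁,S₁} = ⋯ = β_{G_m,S_m}. -/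
open scoped Pointwise

theorem wlen_le_iff_of_mul_closed {G : Type*} [Group G] (B : ℕ → Set G) (h_zero : B 0 = {1})
    (h_succ : ∀ r, B (r + 1) = B r * B 1) (h_mono : Monotone B) (h_cover : ∀ g, ∃ r, g ∈ B r)
    (g : G) (r : ℕ) : wlen (B 1) g ≤ r ↔ g ∈ B r := by
  have h_prod : ∀ l : List G, (∀ x ∈ l, x ∈ B 1) → l.prod ∈ B l.length := by
    intro l
    induction l using List.reverseRecOn with
    | nil => simp [h_zero]
    | append_singleton l a ih =>
      intro h
      rw [List.prod_append, List.prod_singleton, List.length_append, List.length_singleton,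
        h_succ]
      exact Set.mul_mem_mul (ih fun x hx => h x (by simp [hx])) (h a (by simp))
  have h_list : ∀ r, ∀ g ∈ B r, ∃ l : List G, (∀ x ∈ l, x ∈ B 1) ∧ l.length = r ∧ l.prod = g := by
    intro r
    induction r with
    | zero =>
      intro g hg
      rw [h_zero] at hg
      exact ⟨[], by simp, rfl, by simpa using hg.symm⟩
    | succ r ih =>
      intro g hg
      rw [h_succ] at hg
      obtain ⟨a, ha, b, hb, rfl⟩ := hg
      obtain ⟨l, hl, rfl, rfl⟩ := ih a ha
      refine ⟨l ++ [b], ?_, by simp, by simp⟩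
      intro x hx
      rcases List.mem_append.1 hx with hx | hx
      · exact hl x hx
      · rw [List.mem_singleton.1 hx]; exact hb
  constructor
  · intro h
    obtain ⟨k, hk⟩ := h_cover g
    obtain ⟨l, hl, hlen, rfl⟩ := Nat.sInf_mem (s := {n | ∃ l : List G, (∀ x ∈ l, x ∈ B 1) ∧
      l.length = n ∧ l.prod = g}) ⟨k, h_list k g hk⟩
    exact h_mono (hlen.trans_le h) (h_prod l hl)
  · intro h
    exact Nat.sInf_le (h_list r g h)

theorem isMonGenSet_of_mul_closed {G : Type*} [Group G] (B : ℕ → Set G) (h_zero : B 0 = {1})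
    (h_succ : ∀ r, B (r + 1) = B r * B 1) (h_cover : ∀ g, ∃ r, g ∈ B r) :
    IsMonGenSet (B 1) := by
  have h : ∀ r, B r ⊆ Submonoid.closure (B 1) := by
    intro r
    induction r with
    | zero => simp [h_zero]
    | succ r ih =>
      rw [h_succ]
      rintro _ ⟨a, ha, b, hb, rfl⟩
      exact mul_mem (ih ha) (Submonoid.subset_closure hb)
  refine (Submonoid.eq_top_iff' _).2 fun g => ?_
  obtain ⟨r, hr⟩ := h_cover g
  exact h r hr

/-- The box in `ℤ^d` of radius `r * N` in the direction `i₀` and `r` in the other directions. -/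
def intBox {d : ℕ} (i₀ : Fin d) (N r : ℕ) : Set (Fin d → ℤ) :=
  {w | |w i₀| ≤ r * N ∧ ∀ i, i ≠ i₀ → |w i| ≤ r}

/-- The box in `ℤ^d × F` whose face `v i₀ = C * r` carries only the trivial element of `F`. -/
def twistedBox {d : ℕ} (i₀ : Fin d) (F : Type*) [Group F] (C r : ℕ) :
    Set (Multiplicative (Fin d → ℤ) × F) :=
  {g | (-(C * r : ℤ) ≤ g.1.toAdd i₀ ∧
      (g.1.toAdd i₀ < C * r ∨ g.1.toAdd i₀ = C * r ∧ g.2 = 1)) ∧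
    ∀ i, i ≠ i₀ → |g.1.toAdd i| ≤ r}

theorem intBox_finite {d : ℕ} (i₀ : Fin d) (N r : ℕ) : (intBox i₀ N r).Finite := by
  refine (Set.finite_Icc (fun _ => -(r * N + r : ℤ)) (fun _ => (r * N + r : ℤ))).subset ?_
  rintro w ⟨h₀, h⟩
  have h_abs : ∀ i, |w i| ≤ r * N + r := by
    intro i
    have : (0 : ℤ) ≤ r * N := by positivity
    by_cases hi : i = i₀
    · subst hi; lia
    · have := h i hi; lia
  exact ⟨fun i => (abs_le.1 (h_abs i)).1, fun i => (abs_le.1 (h_abs i)).2⟩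

theorem exists_mem_intBox {d : ℕ} (i₀ : Fin d) {N : ℕ} (hN : 0 < N) (w : Fin d → ℤ) :
    ∃ r, w ∈ intBox i₀ N r := by
  have h : ∀ i, |w i| ≤ ((∑ i, (w i).natAbs : ℕ) : ℤ) := by
    intro i
    rw [Int.abs_eq_natAbs]
    exact_mod_cast Finset.single_le_sum (f := fun i => (w i).natAbs) (by simp) (Finset.mem_univ i)
  refine ⟨∑ i, (w i).natAbs, (h i₀).trans ?_, fun i _ => h i⟩
  exact_mod_cast Nat.le_mul_of_pos_right _ hN

section TwistedBox

variable {d : ℕ} (i₀ : Fin d) (F : Type*) [Group F] (C : ℕ)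

theorem twistedBox_zero : twistedBox i₀ F C 0 = {1} := by
  ext ⟨v, f⟩
  simp only [twistedBox, Set.mem_ofPred_eq, Set.mem_singleton_iff, Prod.mk_eq_one, Nat.cast_zero,
    mul_zero, neg_zero]
  constructor
  · rintro ⟨⟨h₁, h₂⟩, h⟩
    have h₃ : v.toAdd i₀ = 0 ∧ f = 1 := by
      rcases h₂ with h₂ | h₂
      · lia
      · exact h₂
    refine ⟨?_, h₃.2⟩
    apply Multiplicative.toAdd.injective
    funext i
    by_cases hi : i = i₀
    · subst hi; exact h₃.1
    · exact abs_nonpos_iff.1 (h i hi)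
  · rintro ⟨rfl, rfl⟩
    simp

theorem twistedBox_succ (hC : 0 < C) (r : ℕ) :
    twistedBox i₀ F C (r + 1) = twistedBox i₀ F C r * twistedBox i₀ F C 1 := by
  have h_exp : (C * (r + 1 : ℕ) : ℤ) = C * r + C := by push_cast; ring
  have h_nonneg : (0 : ℤ) ≤ C * r := by positivity
  ext ⟨v, f⟩
  constructor
  · rintro ⟨⟨h₁, h₂⟩, h⟩
    simp only [h_exp] at h₁ h₂
    obtain ⟨x, a, y, b, hxy, hab, hx, hxa, hy, hyb⟩ : ∃ (x : ℤ) (a : F) (y : ℤ) (b : F),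
        x + y = v.toAdd i₀ ∧ a * b = f ∧ -(C * r : ℤ) ≤ x ∧ (x < C * r ∨ x = C * r ∧ a = 1) ∧
          -(C : ℤ) ≤ y ∧ (y < C ∨ y = C ∧ b = 1) := by
      by_cases h_ge : (C * r : ℤ) ≤ v.toAdd i₀
      · refine ⟨C * r, 1, v.toAdd i₀ - C * r, f, by ring, one_mul f, by lia, by simp, by lia, ?_⟩
        rcases h₂ with h₂ | ⟨h₂, hf⟩
        · left; lia
        · right; exact ⟨by lia, hf⟩
      · by_cases h_low : -(C * r : ℤ) ≤ v.toAdd i₀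
        · exact ⟨v.toAdd i₀, f, 0, 1, by ring, mul_one f, h_low, by left; lia, by lia,
            by left; lia⟩
        · refine ⟨-(C * r), 1, v.toAdd i₀ + C * r, f, by ring, one_mul f, le_rfl, ?_, by lia,
            by left; lia⟩
          by_cases h_zero : (C * r : ℤ) = 0
          · right; simp [h_zero]
          · left; lia
    have h_split : ∀ i, ∃ p q : ℤ, p + q = v.toAdd i ∧ (i ≠ i₀ → |p| ≤ r ∧ |q| ≤ 1) := by
      intro i
      by_cases hi : i = i₀
      · exact ⟨v.toAdd i, 0, by ring, by simp [hi]⟩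
      · have hv := abs_le.1 (h i hi)
        simp only at hv
        push_cast at hv
        refine ⟨v.toAdd i - max (-1) (min 1 (v.toAdd i)), max (-1) (min 1 (v.toAdd i)), by ring,
          fun _ => ⟨abs_le.2 ?_, abs_le.2 ?_⟩⟩ <;> constructor <;> lia
    choose p q hpq hpq_le using h_split
    refine ⟨(Multiplicative.ofAdd (Function.update p i₀ x), a), ?_,
      (Multiplicative.ofAdd (Function.update q i₀ y), b), ?_, ?_⟩
    · refine ⟨⟨by simpa using hx, by simpa using hxa⟩, fun i hi => ?_⟩
      simpa [hi] using (hpq_le i hi).1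
    · refine ⟨⟨by simpa using hy, by simpa using hyb⟩, fun i hi => ?_⟩
      simpa [hi] using (hpq_le i hi).2
    · refine Prod.ext (Multiplicative.toAdd.injective (funext fun i => ?_)) hab
      by_cases hi : i = i₀
      · subst hi; simpa using hxy
      · simpa [hi] using hpq i
  · rintro ⟨⟨u, a⟩, ⟨⟨hu₁, hu₂⟩, hu⟩, ⟨w, b⟩, ⟨⟨hw₁, hw₂⟩, hw⟩, h_eq⟩
    obtain ⟨rfl, rfl⟩ := Prod.mk.inj h_eq
    simp only [Nat.cast_one, mul_one] at hu₁ hu₂ hu hw₁ hw₂ hw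
    refine ⟨⟨?_, ?_⟩, fun i hi => ?_⟩
    · simp only [h_exp, toAdd_mul, Pi.add_apply]; lia
    · simp only [h_exp, toAdd_mul, Pi.add_apply]
      rcases hu₂ with hu₂ | ⟨hu₂, ha⟩
      · left; lia
      · rcases hw₂ with hw₂ | ⟨hw₂, hb⟩
        · left; lia
        · right; exact ⟨by lia, by rw [ha, hb, one_mul]⟩
    · simp only [toAdd_mul, Pi.add_apply]
      push_cast
      exact (abs_add_le _ _).trans (add_le_add (hu i hi) (hw i hi))

theorem twistedBox_mono (hC : 0 < C) : Monotone (twistedBox i₀ F C) := by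
  refine monotone_nat_of_le_succ fun r g hg => ?_
  rw [twistedBox_succ i₀ F C hC]
  exact ⟨g, hg, 1, by simp [twistedBox, hC], mul_one g⟩

/-- The boxes in `ℤ^d × F` are identified with boxes in `ℤ^d` by interleaving `F` into a
coordinate. -/
theorem exists_bijective_mem_intBox_iff [Finite F] :
    ∃ φ : Multiplicative (Fin d → ℤ) × F → (Fin d → ℤ), Function.Bijective φ ∧
      ∀ g r, φ g ∈ intBox i₀ (C * Nat.card F) r ↔ g ∈ twistedBox i₀ F C r := by
  have h_card : 0 < Nat.card F := Nat.card_pos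
  have : NeZero (Nat.card F) := ⟨h_card.ne'⟩
  obtain ⟨e, he⟩ : ∃ e : F ≃ Fin (Nat.card F), e 1 = 0 :=
    ⟨(Finite.equivFin F).trans (Equiv.swap (Finite.equivFin F 1) 0), by simp⟩
  generalize Nat.card F = n at *
  have he' : ∀ f, (e f : ℕ) = 0 ↔ f = 1 := by
    intro f
    rw [← e.injective.eq_iff, he, Fin.ext_iff, Fin.val_zero]
  refine ⟨fun g => Function.update g.1.toAdd i₀ (n * g.1.toAdd i₀ + (e g.2 : ℕ)), ⟨?_, ?_⟩, ?_⟩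
  · rintro ⟨v, f⟩ ⟨v', f'⟩ h
    have h₀ := congrFun h i₀
    simp only [Function.update_self] at h₀
    have hf := (e f).isLt
    have hf' := (e f').isLt
    have h_div : v.toAdd i₀ = v'.toAdd i₀ := by
      by_contra h_ne
      rcases lt_or_gt_of_ne h_ne with h_lt | h_lt <;> nlinarith
    refine Prod.ext (Multiplicative.toAdd.injective (funext fun i => ?_)) (e.injective (Fin.ext ?_))
    · by_cases hi : i = i₀
      · subst hi; exact h_div
      · simpa [hi] using congrFun h i
    · rw [h_div] at h₀
      simpa using h₀
  · intro w
    have h_mod := Int.emod_nonneg (w i₀) (b := n) (by lia)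
    have h_lt := Int.emod_lt_of_pos (w i₀) (b := n) (by lia)
    refine ⟨(Multiplicative.ofAdd (Function.update w i₀ (w i₀ / n)),
      e.symm ⟨(w i₀ % n).toNat, by lia⟩), funext fun i => ?_⟩
    by_cases hi : i = i₀
    · subst hi
      simp only [toAdd_ofAdd, Function.update_self, Equiv.apply_symm_apply,
        Int.toNat_of_nonneg h_mod]
      exact Int.mul_ediv_add_emod _ _
    · simp [hi]
  · rintro ⟨v, f⟩ r
    have hf := (e f).isLt
    simp only [intBox, twistedBox, Set.mem_ofPred_eq, Function.update_self, abs_le, ← he' f]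
    refine and_congr (and_congr ?_ ?_) (forall₂_congr fun i hi => by
      rw [Function.update_of_ne hi])
    · push_cast
      constructor
      · intro h; by_contra! h_lt; nlinarith
      · intro h; nlinarith
    · push_cast
      constructor
      · intro h
        rcases lt_trichotomy (v.toAdd i₀) (C * r) with h_lt | h_eq | h_gt
        · exact Or.inl h_lt
        · refine Or.inr ⟨h_eq, ?_⟩
          rw [h_eq] at h
          have : ((e f : ℕ) : ℤ) ≤ 0 := by linarith
          lia
        · nlinarith
      · rintro (h | ⟨h, h'⟩)
        · nlinarith
        · rw [h, h']
          apply le_of_eq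
          push_cast
          ring

end TwistedBox

theorem exists_genSet_wlen_le_iff {d : ℕ} (i₀ : Fin d) (F : Type*) [Group F] [Finite F] {C : ℕ}
    (hC : 0 < C) :
    ∃ S : Set (Multiplicative (Fin d → ℤ) × F), S.Finite ∧ IsMonGenSet S ∧
      ∃ φ : Multiplicative (Fin d → ℤ) × F → (Fin d → ℤ), Function.Bijective φ ∧
        ∀ g r, wlen S g ≤ r ↔ φ g ∈ intBox i₀ (C * Nat.card F) r := by
  obtain ⟨φ, hφ, h_iff⟩ := exists_bijective_mem_intBox_iff i₀ F C
  have h_cover : ∀ g, ∃ r, g ∈ twistedBox i₀ F C r := fun g =>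
    (exists_mem_intBox i₀ (Nat.mul_pos hC Nat.card_pos) (φ g)).imp fun r => (h_iff g r).1
  have h_succ := twistedBox_succ i₀ F C hC
  have h_zero := twistedBox_zero i₀ F C
  refine ⟨twistedBox i₀ F C 1, ?_, isMonGenSet_of_mul_closed _ h_zero h_succ h_cover, φ, hφ,
    fun g r => ?_⟩
  · exact ((intBox_finite i₀ _ 1).preimage hφ.injective.injOn).subset fun g => (h_iff g 1).2
  · rw [h_iff]
    exact wlen_le_iff_of_mul_closed _ h_zero h_succ (twistedBox_mono i₀ F C hC) h_cover g r

theorem growth_eq_of_bijective {G X : Type*} [Group G] {S : Set G} {T : ℕ → Set X} {φ : G → X}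
    (hφ : Function.Bijective φ) (h : ∀ g r, wlen S g ≤ r ↔ φ g ∈ T r) :
    growth S = fun r => (T r).ncard := by
  funext r
  rw [← Set.ncard_preimage_of_injective_subset_range hφ.injective (s := T r)
    (by simp [hφ.surjective.range_eq])]
  exact congrArg Set.ncard (Set.ext fun g => h g r)

theorem sph_eq_of_bijective {G X : Type*} [Group G] {S : Set G} {T : ℕ → Set X} {φ : G → X}
    (hφ : Function.Bijective φ) (h : ∀ g r, wlen S g ≤ r ↔ φ g ∈ T r) :
    sph S = fun r => {x | x ∈ T r ∧ ∀ k < r, x ∉ T k}.ncard := by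
  funext r
  rw [← Set.ncard_preimage_of_injective_subset_range hφ.injective
    (s := {x | x ∈ T r ∧ ∀ k < r, x ∉ T k}) (by simp [hφ.surjective.range_eq])]
  refine congrArg Set.ncard (Set.ext fun g => ?_)
  simp only [Set.mem_ofPred_eq, Set.mem_preimage, ← h, not_le]
  exact ⟨fun hg => ⟨hg.le, fun k hk => hk.trans_eq hg.symm⟩,
    fun ⟨h₁, h₂⟩ => h₁.antisymm (not_lt.1 fun h_lt => lt_irrefl _ (h₂ _ h_lt))⟩

/-- Witnesses in the monoid case: for finite groups `F₁, …, F_m` and `d > 0`, the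
groups `G_j = ℤ^d × F_j` admit finite monoid generating sets with equal spherical
growth functions, and thus equal growth functions. -/
theorem exists_monoid_witnesses (m : ℕ) (hm : 0 < m) (d : ℕ) (hd : 0 < d)
    (F : Fin m → Type*) [∀ j, Group (F j)] [∀ j, Finite (F j)] :
    ∃ S : (j : Fin m) → Set (Multiplicative (Fin d → ℤ) × F j),
      (∀ j, (S j).Finite ∧ IsMonGenSet (S j)) ∧
      (∀ j k, sph (S j) = sph (S k)) ∧
      (∀ j k, growth (S j) = growth (S k)) := by
  have h_pos : ∀ j, 0 < ∏ k ∈ Finset.univ.erase j, Nat.card (F k) := fun j =>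
    Finset.prod_pos fun k _ => Nat.card_pos
  choose S hS_fin hS_gen φ hφ h_wlen using
    fun j => exists_genSet_wlen_le_iff (⟨0, hd⟩ : Fin d) (F j) (h_pos j)
  simp only [Finset.prod_erase_mul _ _ (Finset.mem_univ _)] at h_wlen
  refine ⟨S, fun j => ⟨hS_fin j, hS_gen j⟩, fun j k => ?_, fun j k => ?_⟩
  · rw [sph_eq_of_bijective (hφ j) (h_wlen j), sph_eq_of_bijective (hφ k) (h_wlen k)]
  · rw [growth_eq_of_bijective (hφ j) (h_wlen j), growth_eq_of_bijective (hφ k) (h_wlen k)]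
end

section
/- Let d ∈ ℕ and let S ⊆ ℤ^d be a finite monoid generating set of ℤ^d (as an additive monoid). Then β_{ℤ^d,S}(r) ≥ β⁺_d(r) for all r ∈ ℕ. -/
section PositiveSpanning

open Module

variable {κ V : Type*} [AddCommGroup V] [Module ℚ V]

/-- A minimal positive linear relation among the vectors `a i`: it lives on a set `F` of nonzero
vectors, has positive coefficients, and every relation on `F` is a multiple of it. -/
theorem exists_positive_circuit (a : κ → V)
    (ha : ∀ v, ∃ n : ℕ, 0 < n ∧ ∃ s : Multiset κ, (s.map a).sum = n • v) (hV : Nontrivial V) :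
    ∃ (F : Finset κ) (c : κ → ℚ), F.Nonempty ∧ (∀ i ∈ F, a i ≠ 0) ∧ (∀ i ∈ F, 0 < c i) ∧
      ∑ i ∈ F, c i • a i = 0 ∧
      ∀ b : κ → ℚ, ∑ i ∈ F, b i • a i = 0 → ∃ t : ℚ, ∀ i ∈ F, b i = t * c i := by
  classical
  let P : Finset κ → Prop := fun F => F.Nonempty ∧ (∀ i ∈ F, a i ≠ 0) ∧
    ∃ c : κ → ℚ, (∀ i ∈ F, 0 < c i) ∧ ∑ i ∈ F, c i • a i = 0
  have hP : ∃ F, P F := by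
    obtain ⟨v, hv⟩ := exists_ne (0 : V)
    obtain ⟨n, hn, s, hs⟩ := ha v
    obtain ⟨n', hn', s', hs'⟩ := ha (-v)
    have hsum : ((n' • s + n • s').map a).sum = 0 := by
      rw [Multiset.map_add, Multiset.sum_add, Multiset.map_nsmul, Multiset.map_nsmul,
        Multiset.sum_nsmul, Multiset.sum_nsmul, hs, hs', smul_neg, smul_neg, smul_comm]
      simp
    obtain ⟨i, hi, hi0⟩ : ∃ i ∈ s, a i ≠ 0 := by
      by_contra! h
      have : (s.map a).sum = 0 := Multiset.sum_eq_zero (by simpa using h)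
      rw [this] at hs
      have h2 : (n : ℚ) • v = 0 := by rw [Nat.cast_smul_eq_nsmul, ← hs]
      rcases smul_eq_zero.1 h2 with h3 | h3
      · simp at h3; omega
      · exact hv h3
    set m := n' • s + n • s' with hm
    refine ⟨m.toFinset.filter (fun i => a i ≠ 0), ⟨i, ?_⟩, ?_, fun j => m.count j, ?_, ?_⟩
    · simp only [Finset.mem_filter, Multiset.mem_toFinset, hm, Multiset.mem_add]
      exact ⟨Or.inl (Multiset.mem_nsmul.2 ⟨hn'.ne', hi⟩), hi0⟩
    · intro j hj
      exact (Finset.mem_filter.1 hj).2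
    · intro j hj
      have := (Finset.mem_filter.1 hj).1
      rw [Multiset.mem_toFinset] at this
      exact Nat.cast_pos.2 (Multiset.count_pos.2 this)
    · rw [Finset.sum_filter_of_ne]
      · rw [← hsum, Finset.sum_multiset_map_count]
        exact Finset.sum_congr rfl fun j _ => Nat.cast_smul_eq_nsmul _ _ _
      · intro j _ h h0
        exact h (by rw [h0, smul_zero])
  obtain ⟨F, ⟨hF, hF0, c, hc, hrel⟩, hmin⟩ : ∃ F, P F ∧ ∀ G, G ⊂ F → ¬ P G := by
    obtain ⟨F, hF, hmin⟩ := WellFounded.has_min (wellFounded_lt (α := Finset κ)) {F | P F} hP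
    exact ⟨F, hF, fun G hG hPG => hmin G hPG hG⟩
  have key : ∀ b : κ → ℚ, ∑ i ∈ F, b i • a i = 0 → (∃ i ∈ F, 0 < b i) →
      ∃ t : ℚ, ∀ i ∈ F, b i = t * c i := by
    rintro b hb ⟨i, hi, hbi⟩
    obtain ⟨j, hj, hjmin⟩ := Finset.exists_min_image (F.filter fun i => 0 < b i)
      (fun i => c i / b i) ⟨i, Finset.mem_filter.2 ⟨hi, hbi⟩⟩
    obtain ⟨hjF, hbj⟩ := Finset.mem_filter.1 hj
    set t := c j / b j with ht
    have htpos : 0 < t := div_pos (hc j hjF) hbj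
    have hnonneg : ∀ i ∈ F, 0 ≤ c i - t * b i := by
      intro i hi
      rcases lt_or_ge 0 (b i) with h | h
      · have := hjmin i (Finset.mem_filter.2 ⟨hi, h⟩)
        rw [le_div_iff₀ h] at this
        linarith
      · nlinarith [hc i hi]
    have hsum : ∑ i ∈ F, (c i - t * b i) • a i = 0 := by
      simp only [sub_smul, mul_smul, Finset.sum_sub_distrib, ← Finset.smul_sum, hrel, hb]
      simp
    have hzero : ∀ i ∈ F, c i - t * b i = 0 := by
      by_contra! h
      obtain ⟨i, hi, hne⟩ := h
      refine hmin (F.filter fun i => c i - t * b i ≠ 0) ?_ ⟨⟨i, Finset.mem_filter.2 ⟨hi, hne⟩⟩,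
        fun i hi => hF0 i (Finset.mem_filter.1 hi).1, fun i => c i - t * b i, ?_, ?_⟩
      · refine Finset.filter_ssubset.2 ⟨j, hjF, ?_⟩
        rw [not_not, ht, div_mul_cancel₀ _ hbj.ne', sub_self]
      · intro i hi
        obtain ⟨h1, h2⟩ := Finset.mem_filter.1 hi
        exact (hnonneg i h1).lt_of_ne' h2
      · rw [Finset.sum_filter_of_ne, hsum]
        intro i _ h h0
        exact h (by simp only [h0, zero_smul])
    refine ⟨t⁻¹, fun i hi => ?_⟩
    rw [sub_eq_zero.1 (hzero i hi), inv_mul_cancel_left₀ htpos.ne']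
  refine ⟨F, c, hF, hF0, hc, hrel, fun b hb => ?_⟩
  by_cases hpos : ∃ i ∈ F, 0 < b i
  · exact key b hb hpos
  by_cases hneg : ∃ i ∈ F, 0 < -b i
  · obtain ⟨t, ht⟩ := key (fun i => -b i) (by simp [hb]) hneg
    exact ⟨-t, fun i hi => by linarith [ht i hi]⟩
  · push Not at hpos hneg
    exact ⟨0, fun i hi => by linarith [hpos i hi, hneg i hi]⟩

/-- If the relations among the vectors `a i` with `i ∈ F` are the multiples of a positive one, they
span a space of dimension `#F - 1`. -/
theorem finrank_range_add_one_of_circuit (a : κ → V) (F : Finset κ) (c : κ → ℚ)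
    (hF : F.Nonempty) (hc : ∀ i ∈ F, 0 < c i) (hrel : ∑ i ∈ F, c i • a i = 0)
    (hmul : ∀ b : κ → ℚ, ∑ i ∈ F, b i • a i = 0 → ∃ t : ℚ, ∀ i ∈ F, b i = t * c i) :
    finrank ℚ (Fintype.linearCombination ℚ (fun i : F => a i)).range + 1 = F.card := by
  classical
  set T := Fintype.linearCombination ℚ (fun i : F => a i) with hT
  have hker : T.ker = Submodule.span ℚ {fun i : F => c i} := by
    ext b
    rw [LinearMap.mem_ker, Submodule.mem_span_singleton, hT, Fintype.linearCombination_apply]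
    constructor
    · intro hb
      obtain ⟨t, ht⟩ := hmul (fun i => if h : i ∈ F then b ⟨i, h⟩ else 0) (by
        rw [← Finset.sum_coe_sort, ← hb]
        exact Finset.sum_congr rfl fun i _ => by simp)
      refine ⟨t, funext fun i => ?_⟩
      have := ht i i.2
      simpa using this.symm
    · rintro ⟨t, rfl⟩
      have : ∑ i : F, c i • a i = 0 := by
        rw [← hrel]; exact Finset.sum_coe_sort F (fun i => c i • a i)
      simp only [Pi.smul_apply, smul_eq_mul, mul_smul, ← Finset.smul_sum, this, smul_zero]
  have h := T.finrank_range_add_finrank_ker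
  rw [hker, finrank_span_singleton, Module.finrank_fintype_fun_eq_card, Fintype.card_coe] at h
  · exact h
  · obtain ⟨i, hi⟩ := hF
    intro h0
    exact (hc i hi).ne' (congrFun h0 ⟨i, hi⟩)

/-- Natural-number combinations of a circuit in which some coefficient vanishes are determined by
their value. -/
theorem eq_of_circuit (a : κ → V) (F : Finset κ) (c : κ → ℚ) (hc : ∀ i ∈ F, 0 < c i)
    (hmul : ∀ b : κ → ℚ, ∑ i ∈ F, b i • a i = 0 → ∃ t : ℚ, ∀ i ∈ F, b i = t * c i)
    (x y : F → ℕ) (hx : ∃ i, x i = 0) (hy : ∃ i, y i = 0)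
    (hxy : ∑ i : F, x i • a i = ∑ i : F, y i • a i) : x = y := by
  classical
  obtain ⟨t, ht⟩ := hmul (fun i => if h : i ∈ F then (x ⟨i, h⟩ : ℚ) - y ⟨i, h⟩ else 0) (by
    rw [← Finset.sum_coe_sort, ← sub_eq_zero.2 hxy, ← Finset.sum_sub_distrib]
    refine Finset.sum_congr rfl fun i _ => ?_
    simp [sub_smul, Nat.cast_smul_eq_nsmul])
  have ht' : ∀ i : F, (x i : ℚ) - y i = t * c i := fun i => by simpa using ht i i.2
  obtain ⟨i, hi⟩ := hx
  obtain ⟨j, hj⟩ := hy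
  have h1 := ht' i
  have h2 := ht' j
  rw [hi] at h1
  rw [hj] at h2
  have ht0 : t = 0 := by
    apply le_antisymm
    · have : (0 : ℚ) ≤ y i := Nat.cast_nonneg _
      have h3 : t * c i ≤ 0 := by rw [← h1]; simp
      exact nonpos_of_mul_nonpos_left h3 (hc i i.2)
    · have h3 : 0 ≤ t * c j := by rw [← h2]; simp
      exact nonneg_of_mul_nonneg_left h3 (hc j j.2)
  funext k
  have := ht' k
  rw [ht0, zero_mul, sub_eq_zero] at this
  exact_mod_cast this

end PositiveSpanning

/-- If the vectors `a i` positively span a space of dimension `d`, the elements of `ℕ^(d+1)` with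
some coordinate zero inject into it so that the image of `z` is a sum of at most `∑ j, z j` of
the vectors. -/
theorem exists_injOn_sum_map {κ : Type*} (d : ℕ) :
    ∀ (V : Type*) [AddCommGroup V] [Module ℚ V] [FiniteDimensional ℚ V] (ι : Type) [Fintype ι]
      (_ : Module.finrank ℚ V = d) (_ : Fintype.card ι = d + 1) (a : κ → V)
      (_ : ∀ v, ∃ n : ℕ, 0 < n ∧ ∃ s : Multiset κ, (s.map a).sum = n • v),
      ∃ φ : (ι → ℕ) → Multiset κ, (∀ z, (φ z).card ≤ ∑ j, z j) ∧
        Set.InjOn (fun z => ((φ z).map a).sum) {z | ∃ j, z j = 0} := by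
  classical
  induction d using Nat.strong_induction_on with
  | _ d ih =>
  intro V _ _ _ ι _ hd hι a ha
  rcases Nat.eq_zero_or_pos d with rfl | hdpos
  · have := Fintype.card_le_one_iff_subsingleton.1 hι.le
    refine ⟨fun _ => 0, fun z => by simp, ?_⟩
    rintro x ⟨i, hi⟩ y ⟨j, hj⟩ _
    funext k
    rw [Subsingleton.elim k i, hi, Subsingleton.elim i j, hj]
  have hV : Nontrivial V := Module.nontrivial_of_finrank_pos (R := ℚ) (by omega)
  obtain ⟨F, c, hF, hF0, hc, hrel, hmul⟩ := exists_positive_circuit a ha hV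
  have hrank := finrank_range_add_one_of_circuit a F c hF hc hrel hmul
  set U := (Fintype.linearCombination ℚ (fun i : F => a i)).range with hU
  have haU : ∀ i ∈ F, a i ∈ U := fun i hi =>
    ⟨Pi.single ⟨i, hi⟩ 1, by simp [Fintype.linearCombination_apply_single]⟩
  have hUpos : 0 < Module.finrank ℚ U := by
    obtain ⟨i, hi⟩ := hF
    have : Nontrivial U := ⟨⟨⟨a i, haU i hi⟩, 0, fun h => hF0 i hi (congrArg Subtype.val h)⟩⟩
    exact Module.finrank_pos
  have hquot := U.finrank_quotient_add_finrank
  set k := Module.finrank ℚ (V ⧸ U) with hk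
  obtain ⟨ψ, hψcard, hψinj⟩ := ih k (by omega) (V ⧸ U) (Option (Fin k)) rfl (by simp)
    (fun i => U.mkQ (a i)) (fun v => by
      obtain ⟨v, rfl⟩ := U.mkQ_surjective v
      obtain ⟨n, hn, s, hs⟩ := ha v
      refine ⟨n, hn, s, ?_⟩
      rw [← map_nsmul, ← hs, map_multiset_sum, Multiset.map_map]
      rfl)
  let e : F ⊕ Fin k ≃ ι := Fintype.equivOfCardEq (by simp; omega)
  have : Nonempty F := hF.to_subtype
  let m : (ι → ℕ) → ℕ := fun z => ⨅ i : F, z (e (.inl i))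
  have hm_le : ∀ z (i : F), m z ≤ z (e (.inl i)) := fun z i => ciInf_le (OrderBot.bddBelow _) i
  have hm_eq : ∀ z, ∃ i : F, z (e (.inl i)) = m z := fun z =>
    Nat.sInf_mem (Set.range_nonempty fun i : F => z (e (.inl i)))
  let w : (ι → ℕ) → Option (Fin k) → ℕ := fun z o => o.elim (m z) fun j => z (e (.inr j))
  refine ⟨fun z => ∑ i : F, (z (e (.inl i)) - m z) • {i.1} + ψ (w z), fun z => ?_, ?_⟩
  · have h1 : ∑ i : F, (z (e (.inl i)) - m z) + m z ≤ ∑ i : F, z (e (.inl i)) := by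
      obtain ⟨i₀, -⟩ := hm_eq z
      calc _ ≤ ∑ i : F, (z (e (.inl i)) - m z) + ∑ i : F, m z := by
            gcongr
            exact Finset.single_le_sum (f := fun _ : F => m z) (fun _ _ => Nat.zero_le _)
              (Finset.mem_univ i₀)
        _ = _ := by
            rw [← Finset.sum_add_distrib]
            exact Finset.sum_congr rfl fun i _ => Nat.sub_add_cancel (hm_le z i)
    have h2 := hψcard (w z)
    rw [Fintype.sum_option] at h2
    rw [← e.sum_comp, Fintype.sum_sum_type, Multiset.card_add, Multiset.card_sum]
    simp only [Multiset.card_nsmul, Multiset.card_singleton, mul_one, w, Option.elim] at h2 ⊢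
    omega
  · have hval : ∀ z, ((∑ i : F, (z (e (.inl i)) - m z) • {i.1} + ψ (w z)).map a).sum =
        ∑ i : F, (z (e (.inl i)) - m z) • a i + ((ψ (w z)).map a).sum := by
      intro z
      rw [Multiset.map_add, Multiset.sum_add, ← Multiset.coe_mapAddMonoidHom, map_sum,
        ← Multiset.coe_sumAddMonoidHom, map_sum]
      simp [Multiset.map_nsmul, Multiset.sum_nsmul]
    have hproj : ∀ z, U.mkQ (∑ i : F, (z (e (.inl i)) - m z) • a i + ((ψ (w z)).map a).sum) =
        ((ψ (w z)).map fun i => U.mkQ (a i)).sum := by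
      intro z
      have h0 : U.mkQ (∑ i : F, (z (e (.inl i)) - m z) • a i) = 0 := by
        rw [← LinearMap.mem_ker, U.ker_mkQ]
        exact U.sum_mem fun i _ => nsmul_mem (haU i i.2) _
      rw [map_add, h0, zero_add, map_multiset_sum, Multiset.map_map]
      rfl
    have hw : ∀ z, (∃ j, z j = 0) → ∃ o, w z o = 0 := by
      rintro z ⟨j, hj⟩
      obtain ⟨j, rfl⟩ := e.surjective j
      rcases j with i | j
      · exact ⟨none, Nat.le_zero.1 (hj ▸ hm_le z i)⟩
      · exact ⟨some j, hj⟩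
    have hsub : ∀ z, ∃ i : F, z (e (.inl i)) - m z = 0 := fun z =>
      (hm_eq z).imp fun i hi => by rw [hi, Nat.sub_self]
    intro z hz z' hz' h
    replace h := (hval z).symm.trans (h.trans (hval z'))
    have hww : w z = w z' := hψinj (hw z hz) (hw z' hz')
      ((hproj z).symm.trans ((congrArg U.mkQ h).trans (hproj z')))
    have hmm : m z = m z' := congrFun hww none
    rw [hww, add_left_inj] at h
    have hx := eq_of_circuit a F c hc hmul _ _ (hsub z) (hsub z') h
    funext j
    obtain ⟨j, rfl⟩ := e.surjective j
    rcases j with i | j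
    · have h1 := congrFun hx i
      have h2 := hm_le z i
      have h3 := hm_le z' i
      omega
    · exact congrFun hww (some j)

section Growth

variable {G : Type*} [Group G]

theorem wlen_le_length {S : Set G} {l : List G} (hl : ∀ x ∈ l, x ∈ S) :
    wlen S l.prod ≤ l.length :=
  Nat.sInf_le ⟨l, hl, rfl, rfl⟩

theorem IsMonGenSet.exists_list {S : Set G} (hS : IsMonGenSet S) (g : G) :
    ∃ l : List G, (∀ x ∈ l, x ∈ S) ∧ l.length = wlen S g ∧ l.prod = g := by
  obtain ⟨l, hl, hg⟩ := Submonoid.exists_list_of_mem_closure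
    (show g ∈ Submonoid.closure S from hS ▸ Submonoid.mem_top g)
  exact Nat.sInf_mem (s := {n | ∃ l : List G, (∀ x ∈ l, x ∈ S) ∧ l.length = n ∧ l.prod = g})
    ⟨_, l, hl, rfl, hg⟩

theorem IsMonGenSet.finite_ball {S : Set G} (hS : IsMonGenSet S) (hfin : S.Finite) (r : ℕ) :
    {g : G | wlen S g ≤ r}.Finite := by
  have := hfin.to_subtype
  refine ((List.finite_length_le S r).image fun l => (l.map Subtype.val).prod).subset ?_
  intro g hg
  obtain ⟨l, hl, hlen, hprod⟩ := hS.exists_list g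
  lift l to List S using hl
  exact ⟨l, by simpa using hlen.trans_le hg, hprod⟩

end Growth

/-- The vector with coordinates `x` with respect to the standard monoid generating set. -/
def stdMonEval {d : ℕ} (x : Option (Fin d) → ℕ) : Multiplicative (Fin d → ℤ) :=
  Multiplicative.ofAdd fun i => (x (some i) : ℤ) - x none

theorem isMonGenSet_stdMonSet (d : ℕ) : IsMonGenSet (stdMonSet d) := by
  rw [IsMonGenSet, eq_top_iff]
  intro g _
  let m : ℕ := ∑ i, (g.toAdd i).natAbs
  have hm : ∀ i, 0 ≤ g.toAdd i + m := fun i => by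
    have : (g.toAdd i).natAbs ≤ m :=
      Finset.single_le_sum (f := fun i => (g.toAdd i).natAbs) (fun _ _ => Nat.zero_le _)
        (Finset.mem_univ i)
    omega
  have hg : g = (Multiplicative.ofAdd fun _ => (-1 : ℤ)) ^ m *
      ∏ i, (Multiplicative.ofAdd (Pi.single i (1 : ℤ))) ^ (g.toAdd i + m).toNat := by
    apply Multiplicative.toAdd.injective
    funext j
    simp [toAdd_prod, Finset.sum_apply, Pi.single_apply, hm]
  rw [hg]
  have hmem : ∀ x ∈ stdMonSet d, x ∈ Submonoid.closure (stdMonSet d) :=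
    fun x hx => Submonoid.subset_closure hx
  exact mul_mem (pow_mem (hmem _ (Or.inr rfl)) _)
    (prod_mem fun i _ => pow_mem (hmem _ (Or.inl ⟨i, rfl⟩)) _)

theorem exists_stdMonEval_eq_prod {d : ℕ} (l : List (Multiplicative (Fin d → ℤ)))
    (hl : ∀ x ∈ l, x ∈ stdMonSet d) :
    ∃ x : Option (Fin d) → ℕ, ∑ j, x j = l.length ∧ stdMonEval x = l.prod := by
  induction l with
  | nil => exact ⟨0, by simp, by apply Multiplicative.toAdd.injective; funext i; simp [stdMonEval]⟩
  | cons g l ih =>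
    obtain ⟨x, hx, hxl⟩ := ih fun y hy => hl y (List.mem_cons_of_mem _ hy)
    obtain ⟨o, ho⟩ : ∃ o, g = stdMonEval (Pi.single o 1) := by
      rcases hl g List.mem_cons_self with ⟨i, rfl⟩ | rfl
      · refine ⟨some i, congrArg _ (funext fun j => ?_)⟩
        simp [Pi.single_apply]
      · refine ⟨none, congrArg _ (funext fun j => ?_)⟩
        simp
    refine ⟨x + Pi.single o 1, by simp [Finset.sum_add_distrib, hx], ?_⟩
    rw [List.prod_cons, ← hxl, ho]
    apply Multiplicative.toAdd.injective
    funext i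
    simp [stdMonEval]
    ring

theorem exists_stdMonEval_eq {d r : ℕ} (g : Multiplicative (Fin d → ℤ))
    (hg : wlen (stdMonSet d) g ≤ r) :
    ∃ x : Option (Fin d) → ℕ, (∃ j, x j = 0) ∧ ∑ j, x j ≤ r ∧ stdMonEval x = g := by
  obtain ⟨l, hl, hlen, rfl⟩ := (isMonGenSet_stdMonSet d).exists_list g
  obtain ⟨x, hx, hxl⟩ := exists_stdMonEval_eq_prod l hl
  obtain ⟨j, hj⟩ := Finite.exists_min x
  refine ⟨fun i => x i - x j, ⟨j, Nat.sub_self _⟩, ?_, ?_⟩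
  · calc ∑ i, (x i - x j) ≤ ∑ i, x i := Finset.sum_le_sum fun i _ => Nat.sub_le _ _
      _ ≤ r := by omega
  · rw [← hxl]
    apply Multiplicative.toAdd.injective
    funext i
    simp only [stdMonEval, toAdd_ofAdd]
    have h1 := hj (some i)
    have h2 := hj none
    omega

/-- The inclusion of `ℤ^d` into `ℚ^d`. -/
def ratVector {d : ℕ} : Multiplicative (Fin d → ℤ) →* Multiplicative (Fin d → ℚ) :=
  AddMonoidHom.toMultiplicative ((Int.castAddHom ℚ).compLeft (Fin d))

theorem exists_nsmul_eq_ratVector {d : ℕ} (v : Fin d → ℚ) :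
    ∃ n : ℕ, 0 < n ∧ ∃ g, (ratVector g).toAdd = n • v := by
  refine ⟨∏ i, (v i).den, Finset.prod_pos fun i _ => (v i).den_pos, ?_⟩
  have h : ∀ i, ∃ z : ℤ, (z : ℚ) = (∏ j, (v j).den : ℕ) * v i := fun i => by
    obtain ⟨q, hq⟩ := Finset.dvd_prod_of_mem (fun j => (v j).den) (Finset.mem_univ i)
    refine ⟨q * (v i).num, ?_⟩
    rw [hq]
    push_cast
    rw [mul_comm ((v i).den : ℚ), mul_assoc, Rat.den_mul_eq_num]
  choose z hz using h
  refine ⟨Multiplicative.ofAdd z, funext fun i => ?_⟩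
  rw [Pi.smul_apply, nsmul_eq_mul, ← hz]
  rfl

/-- Minimal growth of free Abelian groups, monoid case: every finite monoid
generating set of `ℤ^d` has growth function at least `β⁺_d`. -/
theorem betaPlus_le_growth (d : ℕ) (S : Set (Multiplicative (Fin d → ℤ)))
    (hS : S.Finite) (hgen : IsMonGenSet S) :
    ∀ r : ℕ, betaPlus d r ≤ growth S r := by
  intro r
  let a : S → Fin d → ℚ := fun s => (ratVector s.1).toAdd
  have ha : ∀ s : Multiset S, (s.map a).sum = (ratVector (s.map Subtype.val).prod).toAdd := by
    intro s
    induction s using Multiset.induction with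
    | empty => simp
    | cons x s ih => simp [a, ih]
  obtain ⟨φ, hcard, hinj⟩ := exists_injOn_sum_map d (Fin d → ℚ) (Option (Fin d)) (by simp)
    (by simp) a (fun v => by
      obtain ⟨n, hn, g, hg⟩ := exists_nsmul_eq_ratVector v
      obtain ⟨l, hl, -, rfl⟩ := hgen.exists_list g
      lift l to List S using hl
      exact ⟨n, hn, l, by rw [ha, ← hg]; simp⟩)
  let X : Set (Option (Fin d) → ℕ) := {x | (∃ j, x j = 0) ∧ ∑ j, x j ≤ r}
  have hX : X.Finite := by
    refine (Set.finite_Iic (fun _ : Option (Fin d) => r)).subset fun x hx j => ?_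
    exact (Finset.single_le_sum (fun _ _ => Nat.zero_le _) (Finset.mem_univ j)).trans hx.2
  calc betaPlus d r ≤ (stdMonEval '' X).ncard := by
        refine Set.ncard_le_ncard (fun g hg => ?_) (hX.image _)
        obtain ⟨x, h0, hle, rfl⟩ := exists_stdMonEval_eq g hg
        exact ⟨x, ⟨h0, hle⟩, rfl⟩
    _ ≤ X.ncard := Set.ncard_image_le hX
    _ ≤ growth S r := by
        refine Set.ncard_le_ncard_of_injOn (fun x => ((φ x).map Subtype.val).prod) ?_ ?_
          (hgen.finite_ball hS r)
        · intro x hx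
          have h := wlen_le_length (S := S) (l := (φ x).toList.map Subtype.val)
            (List.forall_mem_map.2 fun s _ => s.2)
          rw [← Multiset.prod_coe, ← Multiset.map_coe, Multiset.coe_toList, List.length_map,
            Multiset.length_toList] at h
          exact (h.trans (hcard x)).trans hx.2
        · intro x hx y hy hxy
          refine hinj hx.1 hy.1 ?_
          simp only [ha]
          exact congrArg (fun g => (ratVector g).toAdd) hxy
end
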